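/- arXiv:2109.13369 — 3 statements merged into one kernel-verified Lean document; each statement's English description precedes it below -/
import Mathlib

section
/- Let T₀ < T₁ be reals, I ⊆ ℝ an open interval containing x₀, and ζ : [T₀,T₁] × I → ℂ continuously differentiable with ζ(T₀,x) = x for all x ∈ I and ∂_t ζ(T₀,x₀) = −λ₀ for some λ₀ ∈ ℂ with Im λ₀ ≠ 0. Then there exist δ > 0, c' > 0 and C > 0 such that for all t ∈ (T₀, T₀+δ], all x ∈ ℝ with |x−x₀| ≤ δ, and all z ∈ ℂ with |Im z + (t−T₀)·Im λ₀| ≤ c'·(t−T₀), one has Re((ζ(t,x) − z)²) + (Im z)² ≥ C·(t−T₀)²·(Im λ₀)². -/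
open Set

/-- The key lower bound near the base point: if `ζ` is the complex characteristic
function with `ζ(T₀,x) = x` and `∂_t ζ(T₀,x₀) = −λ₀` with `Im λ₀ ≠ 0`, then for
`t` slightly above `T₀`, `x` near `x₀`, and `z` with
`|Im z + (t−T₀) Im λ₀| ≤ c'(t−T₀)`, one has
`Re((ζ(t,x) − z)²) + (Im z)² ≥ C (t−T₀)² (Im λ₀)²`. -/
theorem fbi_boundary_term_lower_bound
    (T₀ T₁ a b x₀ : ℝ) (hT : T₀ < T₁) (hx₀ : x₀ ∈ Ioo a b)
    (ζ : ℝ × ℝ → ℂ) (hζ : ContDiffOn ℝ 1 ζ (Icc T₀ T₁ ×ˢ Ioo a b))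
    (hinit : ∀ x ∈ Ioo a b, ζ (T₀, x) = (x : ℂ))
    (lam₀ : ℂ) (him : lam₀.im ≠ 0)
    (hderiv : fderivWithin ℝ ζ (Icc T₀ T₁ ×ˢ Ioo a b) (T₀, x₀) (1, 0) = -lam₀) :
    ∃ δ > (0 : ℝ), ∃ c' > (0 : ℝ), ∃ C > (0 : ℝ),
      ∀ t : ℝ, T₀ < t → t ≤ T₀ + δ →
        ∀ x : ℝ, |x - x₀| ≤ δ →
          ∀ z : ℂ, |z.im + (t - T₀) * lam₀.im| ≤ c' * (t - T₀) →
            C * (t - T₀) ^ 2 * lam₀.im ^ 2 ≤ ((ζ (t, x) - z) ^ 2).re + z.im ^ 2 := by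
  set S : Set (ℝ × ℝ) := Icc T₀ T₁ ×ˢ Ioo a b with hS
  have hconv : Convex ℝ S := (convex_Icc T₀ T₁).prod (convex_Ioo a b)
  have hud : UniqueDiffOn ℝ S := (uniqueDiffOn_Icc hT).prod (uniqueDiffOn_Ioo a b)
  have hp : (T₀, x₀) ∈ S := ⟨⟨le_refl _, hT.le⟩, hx₀⟩
  have hcont := hζ.continuousOn_fderivWithin hud (le_refl 1) (T₀, x₀) hp
  set m := |lam₀.im| with hm
  have hmpos : 0 < m := abs_pos.mpr him
  obtain ⟨r, hr, hball⟩ := Metric.continuousWithinAt_iff.mp hcont (m / 8) (by positivity)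
  obtain ⟨ha, hb⟩ := hx₀
  have hδ : ∃ δ > (0 : ℝ), δ < r ∧ δ < x₀ - a ∧ δ < b - x₀ ∧ δ < T₁ - T₀ := by
    have h : 0 < min (min r (x₀ - a)) (min (b - x₀) (T₁ - T₀)) := by
      simp only [lt_min_iff]
      refine ⟨⟨?_, ?_⟩, ?_, ?_⟩ <;> linarith
    obtain ⟨δ, h1, h2⟩ := exists_between h
    simp only [lt_min_iff] at h2
    exact ⟨δ, h1, h2.1.1, h2.1.2, h2.2.1, h2.2.2⟩
  obtain ⟨δ, hδ0, hδr, hδa, hδb, hδT⟩ := hδ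
  refine ⟨δ, hδ0, m / 8, by positivity, 1 / 2, by norm_num, ?_⟩
  intro t ht htδ x hx z hz
  obtain ⟨hx1, hx2⟩ := abs_le.mp hx
  have hxI : x ∈ Ioo a b := ⟨by linarith, by linarith⟩
  have key : ‖ζ (t, x) - ζ (T₀, x) - fderivWithin ℝ ζ S (T₀, x₀) ((t, x) - (T₀, x))‖
      ≤ m / 8 * ‖((t, x) : ℝ × ℝ) - (T₀, x)‖ := by
    refine Convex.norm_image_sub_le_of_norm_hasFDerivWithin_le'
      (s := S ∩ Metric.ball (T₀, x₀) r) (f' := fun p => fderivWithin ℝ ζ S p) ?_ ?_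
      (hconv.inter (convex_ball _ _)) ?_ ?_
    · intro p hp'
      exact ((hζ.differentiableOn one_ne_zero p hp'.1).hasFDerivWithinAt).mono inter_subset_left
    · intro p hp'
      have := hball hp'.1 hp'.2
      rw [dist_eq_norm] at this
      exact this.le
    · refine ⟨⟨⟨le_refl _, hT.le⟩, hxI⟩, ?_⟩
      rw [Metric.mem_ball, Prod.dist_eq, max_lt_iff]
      simp only [Real.dist_eq, sub_self, abs_zero]
      exact ⟨hr, by linarith⟩
    · refine ⟨⟨⟨ht.le, by linarith⟩, hxI⟩, ?_⟩
      rw [Metric.mem_ball, Prod.dist_eq, max_lt_iff]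
      simp only [Real.dist_eq]
      exact ⟨by rw [abs_of_pos] <;> linarith, by linarith⟩
  have hspos : 0 < t - T₀ := by linarith
  have hv : ((t, x) : ℝ × ℝ) - (T₀, x) = (t - T₀) • ((1, 0) : ℝ × ℝ) := by
    ext <;> simp
  have hn : ‖((1, 0) : ℝ × ℝ)‖ = 1 := by simp [Prod.norm_def]
  rw [hv, map_smul, hderiv, hinit x hxI, norm_smul, hn, Real.norm_of_nonneg hspos.le] at key
  have him2 := (Complex.abs_im_le_norm _).trans key
  have e : (ζ (t, x) - (x : ℂ) - (t - T₀) • -lam₀).im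
      = (ζ (t, x)).im + (t - T₀) * lam₀.im := by
    simp
  rw [e] at him2
  clear_value m
  have e2 : ((ζ (t, x) - z) ^ 2).re
      = ((ζ (t, x)).re - z.re) ^ 2 - ((ζ (t, x)).im - z.im) ^ 2 := by
    simp [pow_two]
  rw [e2]
  generalize (ζ (t, x)).im = u at *
  generalize t - T₀ = s at *
  have hd : |u - z.im| ≤ m * s / 4 := by
    rw [abs_le] at *
    constructor <;> linarith
  have hzl : 7 / 8 * (m * s) ≤ |z.im| := by
    have h1 : |s * lam₀.im| = m * s := by rw [abs_mul, abs_of_pos hspos, hm, mul_comm]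
    have h2 := abs_sub (z.im + s * lam₀.im) z.im
    rw [add_sub_cancel_left, h1] at h2
    linarith
  have hms : 0 < m * s := by positivity
  have q1 : (u - z.im) ^ 2 ≤ (m * s / 4) ^ 2 := by
    rw [← sq_abs]; gcongr
  have q2 : (7 / 8 * (m * s)) ^ 2 ≤ z.im ^ 2 := by
    rw [← sq_abs z.im]; gcongr
  have q3 : lam₀.im ^ 2 = m ^ 2 := by rw [hm, sq_abs]
  rw [q3]
  nlinarith [sq_nonneg ((ζ (t, x)).re - z.re), sq_nonneg (m * s)]
end

section
/- Let U ⊆ ℝ^k be open, let M : U → Matrix n n ℂ be infinitely differentiable (C^∞), let x₀ ∈ U, and let λ₀ ∈ ℂ be a simple eigenvalue of M(x₀) (i.e. a root of the characteristic polynomial of M(x₀) of multiplicity exactly 1) with eigenvector X₀ ∈ ℂ^n, X₀ ≠ 0, M(x₀)X₀ = λ₀X₀. Then there exist an open neighborhood V ⊆ U of x₀ and C^∞ functions λ : V → ℂ and X : V → ℂ^n such that λ(x₀) = λ₀, X(x₀) = X₀, and for every x ∈ V: X(x) ≠ 0, M(x)X(x) = λ(x)X(x), and λ(x) is a simple eigenvalue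 of M(x). -/
open Polynomial

open scoped Topology ContDiff

lemma aux_det {E : Type*} [NormedAddCommGroup E] [NormedSpace ℝ E] {n : ℕ}
    {A : E → Matrix (Fin n) (Fin n) ℂ} {v : E}
    (h : ∀ i j, ContDiffAt ℝ (⊤ : ℕ∞) (fun x => A x i j) v) :
    ContDiffAt ℝ (⊤ : ℕ∞) (fun x => (A x).det) v := by
  simp only [Matrix.det_apply]
  refine ContDiffAt.sum fun σ _ => ?_
  refine ContDiffAt.const_smul (Equiv.Perm.sign σ) (contDiffAt_prod fun i _ => h _ _)

lemma aux_adj {E : Type*} [NormedAddCommGroup E] [NormedSpace ℝ E] {n : ℕ}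
    {A : E → Matrix (Fin n) (Fin n) ℂ} {v : E}
    (h : ∀ i j, ContDiffAt ℝ (⊤ : ℕ∞) (fun x => A x i j) v) (i j : Fin n) :
    ContDiffAt ℝ (⊤ : ℕ∞) (fun x => (A x).adjugate i j) v := by
  simp only [Matrix.adjugate_apply]
  refine aux_det fun a b => ?_
  simp only [Matrix.updateRow_apply]
  split_ifs
  · exact contDiffAt_const
  · exact h a b

lemma aux_simple {n : ℕ} (A : Matrix (Fin n) (Fin n) ℂ) (z : ℂ) :
    rootMultiplicity z A.charpoly = 1 ↔
      (Matrix.scalar (Fin n) z - A).det = 0 ∧ A.charpoly.derivative.eval z ≠ 0 := by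
  have h0 : A.charpoly ≠ 0 := A.charpoly_monic.ne_zero
  have h1 := one_lt_rootMultiplicity_iff_isRoot (t := z) h0
  have h2 := rootMultiplicity_pos (x := z) h0
  rw [← Matrix.eval_charpoly]
  simp only [IsRoot.def] at h1 h2
  constructor
  · intro h
    have : A.charpoly.eval z = 0 := h2.1 (by omega)
    refine ⟨this, fun h' => ?_⟩
    have := h1.2 ⟨this, h'⟩
    omega
  · rintro ⟨ha, hb⟩
    have := h2.2 ha
    have : ¬ 1 < rootMultiplicity z A.charpoly := fun h => hb (h1.1 h).2
    omega

lemma aux_eig {n : ℕ} (A : Matrix (Fin n) (Fin n) ℂ) (z : ℂ) (X : Fin n → ℂ)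
    (h : A.mulVec X = z • X) :
    (Matrix.scalar (Fin n) z - A).adjugate.mulVec X = A.charpoly.derivative.eval z • X := by
  have e1 : A.charmatrix.mulVec (fun i => C (X i)) = (Polynomial.X - C z) • fun i => C (X i) := by
    ext1 i
    have hi := congrFun h i
    simp only [Matrix.charmatrix, Matrix.sub_mulVec, Pi.sub_apply, Pi.smul_apply, smul_eq_mul,
      sub_mul]
    congr 1
    · simp [Matrix.scalar_apply, Matrix.mulVec_diagonal]
    · simp only [Matrix.mulVec, dotProduct, Pi.smul_apply, smul_eq_mul] at hi
      simp only [Matrix.mulVec, dotProduct, RingHom.mapMatrix_apply, Matrix.map_apply]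
      rw [← C_mul, ← hi]
      simp
  have e2 : (Polynomial.X - C z) • A.charmatrix.adjugate.mulVec (fun i => C (X i))
      = A.charpoly • fun i => C (X i) := by
    rw [← Matrix.mulVec_smul, ← e1, Matrix.mulVec_mulVec, Matrix.adjugate_mul, Matrix.smul_mulVec,
      Matrix.one_mulVec]
    rfl
  have e3 : (evalRingHom z).mapMatrix A.charmatrix = Matrix.scalar (Fin n) z - A := by
    ext i j
    by_cases hij : i = j
    · subst hij; simp [Matrix.charmatrix_apply]
    · simp [Matrix.charmatrix_apply, hij]
  ext i
  have e4 := congrArg (fun p => p.derivative.eval z) (congrFun e2 i)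
  simp only [Pi.smul_apply, smul_eq_mul, derivative_mul, eval_add, eval_mul, eval_sub, eval_X,
    eval_C, derivative_C, derivative_sub, derivative_X] at e4
  simp only [sub_self, zero_mul, mul_zero, add_zero, sub_zero, eval_one, one_mul, eval_zero] at e4
  rw [Pi.smul_apply, smul_eq_mul, ← e4, ← e3, ← RingHom.map_adjugate]
  simp [Matrix.mulVec, dotProduct, eval_finset_sum]

/-- Smooth dependence of a simple eigenvalue and its eigenvector on parameters:
if `M : U → Matrix n n ℂ` is `C^∞` (entrywise) on an open set `U ⊆ ℝ^k` and `λ₀` is a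
simple eigenvalue of `M(x₀)` with eigenvector `X₀`, then near `x₀` there are `C^∞`
functions `λ(x)`, `X(x)` with `λ(x₀) = λ₀`, `X(x₀) = X₀`, `M(x)X(x) = λ(x)X(x)`,
`X(x) ≠ 0`, and `λ(x)` a simple eigenvalue of `M(x)`. -/
theorem smooth_simple_eigenvalue_eigenvector
    (k n : ℕ) (U : Set (Fin k → ℝ)) (hU : IsOpen U)
    (M : (Fin k → ℝ) → Matrix (Fin n) (Fin n) ℂ)
    (hM : ∀ i j, ContDiffOn ℝ (⊤ : ℕ∞) (fun x => M x i j) U)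
    (x₀ : Fin k → ℝ) (hx₀ : x₀ ∈ U)
    (lam₀ : ℂ) (hsimple : rootMultiplicity lam₀ (M x₀).charpoly = 1)
    (X₀ : Fin n → ℂ) (hX₀ : X₀ ≠ 0) (heig : (M x₀).mulVec X₀ = lam₀ • X₀) :
    ∃ V : Set (Fin k → ℝ), IsOpen V ∧ x₀ ∈ V ∧ V ⊆ U ∧
      ∃ lam : (Fin k → ℝ) → ℂ, ∃ X : (Fin k → ℝ) → (Fin n → ℂ),
        ContDiffOn ℝ (⊤ : ℕ∞) lam V ∧ ContDiffOn ℝ (⊤ : ℕ∞) X V ∧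
        lam x₀ = lam₀ ∧ X x₀ = X₀ ∧
        ∀ x ∈ V, X x ≠ 0 ∧ (M x).mulVec (X x) = lam x • X x ∧
          rootMultiplicity (lam x) (M x).charpoly = 1 := by
  have hMA : ∀ x ∈ U, ∀ i j, ContDiffAt ℝ (⊤ : ℕ∞) (fun x => M x i j) x :=
    fun x hx i j => (hM i j).contDiffAt (hU.mem_nhds hx)
  set A : (Fin k → ℝ) × ℂ → Matrix (Fin n) (Fin n) ℂ :=
    fun v => Matrix.scalar (Fin n) v.2 - M v.1 with hA
  have hAc : ∀ v : (Fin k → ℝ) × ℂ, v.1 ∈ U → ∀ i j,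
      ContDiffAt ℝ (⊤ : ℕ∞) (fun v => A v i j) v := by
    intro v hv i j
    have h1 : ContDiffAt ℝ (⊤ : ℕ∞) (fun v : (Fin k → ℝ) × ℂ => M v.1 i j) v :=
      (hMA v.1 hv i j).comp v contDiffAt_fst
    simp only [hA, Matrix.sub_apply, Matrix.scalar_apply, Matrix.diagonal_apply]
    refine ContDiffAt.sub ?_ h1
    split_ifs
    · exact contDiffAt_snd
    · exact contDiffAt_const
  set f : (Fin k → ℝ) × ℂ → ℂ := fun v => (A v).det with hf
  have hfc : ∀ v : (Fin k → ℝ) × ℂ, v.1 ∈ U → ContDiffAt ℝ (⊤ : ℕ∞) f v :=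
    fun v hv => aux_det (hAc v hv)
  have top0 : ((⊤ : ℕ∞) : WithTop ℕ∞) ≠ 0 := by simp
  -- partial derivative
  have hpd : ∀ v : (Fin k → ℝ) × ℂ, v.1 ∈ U → ∀ w : ℂ,
      fderiv ℝ f v (0, w) = (M v.1).charpoly.derivative.eval v.2 * w := by
    intro v hv w
    have h1 : HasFDerivAt f (fderiv ℝ f v) v := ((hfc v hv).differentiableAt top0).hasFDerivAt
    have h2 : HasFDerivAt (fun z : ℂ => f (v.1, z))
        ((fderiv ℝ f v).comp (ContinuousLinearMap.inr ℝ (Fin k → ℝ) ℂ)) v.2 :=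
      HasFDerivAt.comp v.2 (g := f) (f := fun z : ℂ => (v.1, z)) h1
        (hasFDerivAt_prodMk_right v.1 v.2)
    have h3 : HasDerivAt (fun z : ℂ => f (v.1, z))
        ((M v.1).charpoly.derivative.eval v.2) v.2 := by
      have := (M v.1).charpoly.hasDerivAt v.2
      simpa only [Matrix.eval_charpoly] using this
    have h4 := h2.unique (h3.hasFDerivAt.restrictScalars ℝ)
    have h5 := congrArg (fun L => L w) h4
    simpa [mul_comm] using h5
  have hinv : ∀ v : (Fin k → ℝ) × ℂ, v.1 ∈ U → (M v.1).charpoly.derivative.eval v.2 ≠ 0 →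
      (fderiv ℝ f v ∘L .inr ℝ (Fin k → ℝ) ℂ).IsInvertible := by
    intro v hv hne
    set c := (M v.1).charpoly.derivative.eval v.2 with hc
    refine ContinuousLinearMap.IsInvertible.of_inverse
      (g := ContinuousLinearMap.mul ℝ ℂ c⁻¹) ?_ ?_
    · refine ContinuousLinearMap.ext fun w => ?_
      simp only [ContinuousLinearMap.comp_apply, ContinuousLinearMap.inr_apply, hpd v hv, ← hc]
      simp [hne]
    · refine ContinuousLinearMap.ext fun w => ?_
      simp only [ContinuousLinearMap.comp_apply, ContinuousLinearMap.inr_apply, hpd v hv, ← hc]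
      simp [hne]
  obtain ⟨hf0, hd0⟩ := (aux_simple _ _).1 hsimple
  set v₀ : (Fin k → ℝ) × ℂ := (x₀, lam₀) with hv₀
  have hf0' : f v₀ = 0 := hf0
  have hUv : ∀ᶠ v : (Fin k → ℝ) × ℂ in 𝓝 v₀, v.1 ∈ U :=
    continuous_fst.continuousAt.eventually (hU.mem_nhds hx₀)
  have hdne : ∀ᶠ v : (Fin k → ℝ) × ℂ in 𝓝 v₀,
      (M v.1).charpoly.derivative.eval v.2 ≠ 0 := by
    have hc : ContinuousAt (fun v => fderiv ℝ f v (0, 1)) v₀ :=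
      ((hfc v₀ hx₀).continuousAt_fderiv top0).clm_apply continuousAt_const
    have : fderiv ℝ f v₀ (0, 1) ≠ 0 := by rw [hpd v₀ hx₀, mul_one]; exact hd0
    filter_upwards [hc.eventually_ne this, hUv] with v h1 h2
    rwa [hpd v h2, mul_one] at h1
  have i0 := hinv v₀ hx₀ hd0
  set lam := (hfc v₀ hx₀).implicitFunction top0 i0 with hlam
  have hlam0 : lam x₀ = lam₀ := (hfc v₀ hx₀).implicitFunction_apply_self top0 i0
  have hlamc : ContinuousAt lam x₀ :=
    ((hfc v₀ hx₀).contDiffAt_implicitFunction top0 i0).continuousAt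
  have hiff : ∀ᶠ v in 𝓝 v₀, f v = 0 ↔ lam v.1 = v.2 := by
    have := (hfc v₀ hx₀).eventually_apply_eq_iff_implicitFunction top0 i0
    rwa [hf0'] at this
  have hgr : Filter.Tendsto (fun x => (x, lam x)) (𝓝 x₀) (𝓝 v₀) := by
    have : ContinuousAt (fun x => (x, lam x)) x₀ := continuousAt_id.prodMk hlamc
    have h := this.tendsto
    rwa [hlam0] at h
  have hgood := hgr.eventually ((hUv.and hdne).and hiff.eventually_nhds)
  have hsm : ∀ x, (x ∈ U ∧ (M x).charpoly.derivative.eval (lam x) ≠ 0) →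
      (∀ᶠ v in 𝓝 (x, lam x), f v = 0 ↔ lam v.1 = v.2) →
      f (x, lam x) = 0 ∧ ContDiffAt ℝ (⊤ : ℕ∞) lam x := by
    rintro x ⟨hx, hne⟩ hev
    have hz : f (x, lam x) = 0 := hev.self_of_nhds.2 rfl
    refine ⟨hz, ?_⟩
    have i1 := hinv (x, lam x) hx hne
    have cd := hfc (x, lam x) hx
    have s1 : ContDiffAt ℝ (⊤ : ℕ∞) (cd.implicitFunction top0 i1) x :=
      cd.contDiffAt_implicitFunction top0 i1
    have s2 : cd.implicitFunction top0 i1 x = lam x := cd.implicitFunction_apply_self top0 i1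
    have s3 : ∀ᶠ y in 𝓝 x, f (y, cd.implicitFunction top0 i1 y) = f (x, lam x) :=
      cd.eventually_apply_implicitFunction top0 i1
    have s4 : Filter.Tendsto (fun y => (y, cd.implicitFunction top0 i1 y)) (𝓝 x)
        (𝓝 (x, lam x)) := by
      have : ContinuousAt (fun y => (y, cd.implicitFunction top0 i1 y)) x :=
        continuousAt_id.prodMk s1.continuousAt
      have h := this.tendsto
      rwa [s2] at h
    refine s1.congr_of_eventuallyEq ?_
    filter_upwards [s3, s4.eventually hev] with y h1 h2
    exact h2.1 (h1.trans hz)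
  set c := (M x₀).charpoly.derivative.eval lam₀ with hc
  set X : (Fin k → ℝ) → (Fin n → ℂ) := fun x => c⁻¹ • (A (x, lam x)).adjugate.mulVec X₀ with hX
  have hXs : ∀ x ∈ U, ContDiffAt ℝ (⊤ : ℕ∞) lam x → ContDiffAt ℝ (⊤ : ℕ∞) X x := by
    intro x hx hl
    rw [contDiffAt_pi]
    intro i
    simp only [hX, Pi.smul_apply, Matrix.mulVec, dotProduct, smul_eq_mul]
    refine contDiffAt_const.mul (ContDiffAt.sum fun j _ => ContDiffAt.mul ?_ contDiffAt_const)
    refine aux_adj (A := fun x => A (x, lam x)) (fun a b => ?_) i j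
    exact (hAc (x, lam x) hx a b).comp x (f := fun x => (x, lam x)) (contDiffAt_id.prodMk hl)
  have hX0 : X x₀ = X₀ := by
    have := aux_eig (M x₀) lam₀ X₀ heig
    simp only [hX, hA, hlam0]
    rw [this, smul_smul, inv_mul_cancel₀ hd0, one_smul]
  have hXne : ∀ᶠ x in 𝓝 x₀, X x ≠ 0 := by
    have hg := hgood.self_of_nhds
    have := (hXs x₀ hx₀ (hsm x₀ hg.1 hg.2).2).continuousAt
    exact this.eventually_ne (by rw [hX0]; exact hX₀)
  obtain ⟨V, hV, hVo, hxV⟩ := eventually_nhds_iff.1 (hgood.and hXne)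
  refine ⟨V, hVo, hxV, fun x hx => (hV x hx).1.1.1, lam, X, ?_, ?_, hlam0, hX0, ?_⟩
  · intro x hx
    have h := (hV x hx).1
    exact (hsm x h.1 h.2).2.contDiffWithinAt
  · intro x hx
    have h := (hV x hx).1
    exact (hXs x h.1.1 (hsm x h.1 h.2).2).contDiffWithinAt
  · intro x hx
    obtain ⟨h, hne⟩ := hV x hx
    have hz : (Matrix.scalar (Fin n) (lam x) - M x).det = 0 := (hsm x h.1 h.2).1
    refine ⟨hne, ?_, (aux_simple _ _).2 ⟨hz, h.1.2⟩⟩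
    have : (Matrix.scalar (Fin n) (lam x) - M x).mulVec (X x) = 0 := by
      simp only [hX, hA]
      rw [Matrix.mulVec_smul, Matrix.mulVec_mulVec, Matrix.mul_adjugate, hz]
      simp
    rw [Matrix.sub_mulVec, sub_eq_zero] at this
    rw [← this]
    ext i
    simp [Matrix.scalar_apply, Matrix.mulVec_diagonal]
end

section
/- Let U ⊆ ℝ^k be open, let M : U → Matrix n n ℂ be real-analytic (every entry is a real-analytic function of x ∈ U), let x₀ ∈ U, and let λ₀ ∈ ℂ be a simple eigenvalue of M(x₀) (a root of the characteristic polynomial of M(x₀) of multiplicity exactly 1) with eigenvector X₀ ∈ ℂ^n, X₀ ≠ 0, M(x₀)X₀ = λ₀X₀. Then there exist an open neighborhood V ⊆ U of x₀ and real-analytic functions λ : V → ℂ and X : V → ℂ^n such that λ(x₀) = λ₀, X(x₀) = X₀, and for every x ∈ V: X(x) ≠ 0, M(x)X(x) = λ(x)X(x), and λ(x) is a simple eigenvalue of M(x). -/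
open Polynomial

lemma aux_det_analytic {E : Type*} [NormedAddCommGroup E] [NormedSpace ℝ E] {n : ℕ}
    (A : E → Matrix (Fin n) (Fin n) ℂ) (u : E)
    (hA : ∀ i j, AnalyticAt ℝ (fun x => A x i j) u) :
    AnalyticAt ℝ (fun x => (A x).det) u := by
  simp only [Matrix.det_apply, Units.smul_def, zsmul_eq_mul]
  refine Finset.analyticAt_fun_sum _ fun σ _ => ?_
  refine analyticAt_const.mul ?_
  exact Finset.analyticAt_fun_prod _ fun i _ => hA _ _

lemma aux_adj_analytic {E : Type*} [NormedAddCommGroup E] [NormedSpace ℝ E] {n : ℕ}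
    (A : E → Matrix (Fin n) (Fin n) ℂ) (u : E)
    (hA : ∀ i j, AnalyticAt ℝ (fun x => A x i j) u) (i j : Fin n) :
    AnalyticAt ℝ (fun x => (A x).adjugate i j) u := by
  simp only [Matrix.adjugate_apply]
  refine aux_det_analytic _ u fun a b => ?_
  simp only [Matrix.updateRow_apply]
  split_ifs
  · exact analyticAt_const
  · exact hA a b

lemma aux_entry (n : ℕ) (t : ℂ) (A : Matrix (Fin n) (Fin n) ℂ) (i j : Fin n) :
    (Matrix.scalar (Fin n) t - A) i j = t * (if i = j then 1 else 0) - A i j := by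
  simp [Matrix.diagonal_apply]

lemma aux_adj_eig {n : ℕ} (A : Matrix (Fin n) (Fin n) ℂ) (l : ℂ) (v : Fin n → ℂ)
    (q : ℂ[X]) (hq : A.charpoly = (X - C l) * q) (hv : A.mulVec v = l • v) :
    (Matrix.scalar (Fin n) l - A).adjugate.mulVec v = q.eval l • v := by
  have h1 : A.charmatrix.mulVec (fun i => C (v i)) = (X - C l) • (fun i => C (v i)) := by
    have hv' : (A.map C).mulVec (fun i => C (v i)) = fun i => C (l * v i) := by
      funext i
      have := congrFun hv i
      simp only [Matrix.mulVec, dotProduct, Pi.smul_apply, smul_eq_mul] at this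
      simp [Matrix.mulVec, dotProduct, ← this, map_sum]
    have : A.charmatrix = Matrix.scalar (Fin n) X - A.map C := rfl
    rw [this, Matrix.sub_mulVec, hv']
    funext i
    simp [sub_mul, Matrix.mulVec_diagonal]
  have h2 : A.charmatrix.adjugate.mulVec (fun i => C (v i)) = q • (fun i => C (v i)) := by
    have h3 := congrArg A.charmatrix.adjugate.mulVec h1
    rw [Matrix.mulVec_mulVec, Matrix.adjugate_mul, Matrix.smul_mulVec, Matrix.one_mulVec,
      Matrix.mulVec_smul] at h3
    change A.charpoly • _ = _ at h3
    rw [hq] at h3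
    funext i
    have h4 := congrFun h3 i
    simp only [Pi.smul_apply, smul_eq_mul, mul_assoc] at h4
    exact (mul_left_cancel₀ (X_sub_C_ne_zero l) h4).symm
  have h5 : (Matrix.scalar (Fin n) l - A) = (evalRingHom l).mapMatrix A.charmatrix := by
    ext i j
    simp [Matrix.charmatrix_apply, Matrix.diagonal_apply]
    split_ifs <;> simp
  rw [h5, ← RingHom.map_adjugate]
  funext i
  have h6 := congrArg (eval l) (congrFun h2 i)
  simp only [Matrix.mulVec, dotProduct, eval_finsetSum, eval_mul, eval_C, Pi.smul_apply,
    smul_eq_mul] at h6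
  simpa [Matrix.mulVec, dotProduct] using h6

/-- Real-analytic dependence of a simple eigenvalue and its eigenvector on parameters:
if `M : U → Matrix n n ℂ` is real-analytic (entrywise) on an open set `U ⊆ ℝ^k` and `λ₀`
is a simple eigenvalue of `M(x₀)` with eigenvector `X₀`, then near `x₀` there are
real-analytic functions `λ(x)`, `X(x)` with `λ(x₀) = λ₀`, `X(x₀) = X₀`,
`M(x)X(x) = λ(x)X(x)`, `X(x) ≠ 0`, and `λ(x)` a simple eigenvalue of `M(x)`. -/
theorem analytic_simple_eigenvalue_eigenvector
    (k n : ℕ) (U : Set (Fin k → ℝ)) (hU : IsOpen U)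
    (M : (Fin k → ℝ) → Matrix (Fin n) (Fin n) ℂ)
    (hM : ∀ i j, AnalyticOnNhd ℝ (fun x => M x i j) U)
    (x₀ : Fin k → ℝ) (hx₀ : x₀ ∈ U)
    (lam₀ : ℂ) (hsimple : rootMultiplicity lam₀ (M x₀).charpoly = 1)
    (X₀ : Fin n → ℂ) (hX₀ : X₀ ≠ 0) (heig : (M x₀).mulVec X₀ = lam₀ • X₀) :
    ∃ V : Set (Fin k → ℝ), IsOpen V ∧ x₀ ∈ V ∧ V ⊆ U ∧
      ∃ lam : (Fin k → ℝ) → ℂ, ∃ X : (Fin k → ℝ) → (Fin n → ℂ),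
        AnalyticOnNhd ℝ lam V ∧ AnalyticOnNhd ℝ X V ∧
        lam x₀ = lam₀ ∧ X x₀ = X₀ ∧
        ∀ x ∈ V, X x ≠ 0 ∧ (M x).mulVec (X x) = lam x • X x ∧
          rootMultiplicity (lam x) (M x).charpoly = 1 := by
  classical
  have hne : ∀ x, (M x).charpoly ≠ 0 := fun x => (Matrix.charpoly_monic _).ne_zero
  obtain ⟨q, hq, -⟩ := exists_eq_pow_rootMultiplicity_mul_and_not_dvd _ (hne x₀) lam₀
  rw [hsimple, pow_one] at hq
  have hroot : (M x₀).charpoly.IsRoot lam₀ := by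
    rw [hq]; simp
  have hqd : (derivative (M x₀).charpoly).eval lam₀ = q.eval lam₀ := by
    rw [hq]; simp
  have hd0 : (derivative (M x₀).charpoly).eval lam₀ ≠ 0 := by
    intro h
    have := (one_lt_rootMultiplicity_iff_isRoot (hne x₀)).2 ⟨hroot, h⟩
    omega
  have hc : q.eval lam₀ ≠ 0 := hqd ▸ hd0
  -- the matrix function
  let A : (Fin k → ℝ) × ℂ → Matrix (Fin n) (Fin n) ℂ := fun p => Matrix.scalar (Fin n) p.2 - M p.1
  let f : (Fin k → ℝ) × ℂ → ℂ := fun p => (A p).det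
  have hfe : ∀ p, f p = (M p.1).charpoly.eval p.2 := fun p => (Matrix.eval_charpoly _ _).symm
  have hA : ∀ p : (Fin k → ℝ) × ℂ, p.1 ∈ U → ∀ i j, AnalyticAt ℝ (fun p => A p i j) p := by
    intro p hp i j
    have h1 : AnalyticAt ℝ (fun p : (Fin k → ℝ) × ℂ => M p.1 i j) p :=
      AnalyticAt.comp (g := fun x => M x i j) (hM i j p.1 hp) analyticAt_fst
    simp only [A, aux_entry]
    exact (analyticAt_snd.mul analyticAt_const).sub h1
  have hf : ∀ p : (Fin k → ℝ) × ℂ, p.1 ∈ U → AnalyticAt ℝ f p := fun p hp =>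
    aux_det_analytic A p (hA p hp)
  have hder : ∀ p : (Fin k → ℝ) × ℂ, p.1 ∈ U → ∀ z,
      fderiv ℝ f p (0, z) = (derivative (M p.1).charpoly).eval p.2 * z := by
    intro p hp z
    have h1 : HasFDerivAt f (fderiv ℝ f p) (p.1, p.2) :=
      (hf p hp).differentiableAt.hasFDerivAt
    have h2 := h1.comp p.2 (hasFDerivAt_prodMk_right p.1 p.2)
    have h3 := ((M p.1).charpoly.hasDerivAt p.2).hasFDerivAt.restrictScalars ℝ
    have h4 : (f ∘ fun t => (p.1, t)) = fun t => (M p.1).charpoly.eval t := by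
      funext t; exact hfe _
    rw [h4] at h2
    have h5 := congrArg (fun L => L z) (h2.unique h3)
    simpa [mul_comm] using h5
  let u : (Fin k → ℝ) × ℂ := (x₀, lam₀)
  have hu : u.1 ∈ U := hx₀
  have cdf : ContDiffAt ℝ ⊤ f u := (hf u hu).contDiffAt
  have pn : (⊤ : WithTop ℕ∞) ≠ 0 := by simp
  have if₂ : (fderiv ℝ f u ∘L .inr ℝ (Fin k → ℝ) ℂ).IsInvertible := by
    refine ⟨(ContinuousLinearEquiv.smulLeft (Units.mk0 _ hd0) : ℂ ≃L[ℝ] ℂ), ?_⟩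
    ext z
    all_goals simp [hder u hu, u, Units.smul_def]
  let lam := cdf.implicitFunction pn if₂
  have hlam0 : lam x₀ = lam₀ := cdf.implicitFunction_apply_self pn if₂
  have hlamA : AnalyticAt ℝ lam x₀ :=
    (cdf.contDiffAt_implicitFunction pn if₂).analyticAt
  have hlamE : ∀ᶠ x in nhds x₀, f (x, lam x) = 0 := by
    have h := cdf.eventually_apply_implicitFunction pn if₂
    have h0 : f u = 0 := by rw [hfe]; exact hroot
    rw [h0] at h
    exact h
  let Y : (Fin k → ℝ) → (Fin n → ℂ) := fun x => (q.eval lam₀)⁻¹ • (A (x, lam x)).adjugate.mulVec X₀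
  have hYA : ∀ x ∈ U, AnalyticAt ℝ lam x → AnalyticAt ℝ Y x := by
    intro x hx hl
    have hp : AnalyticAt ℝ (fun x => (x, lam x)) x := analyticAt_id.prod hl
    refine AnalyticAt.pi fun i => ?_
    simp only [Y, Pi.smul_apply, smul_eq_mul, Matrix.mulVec, dotProduct]
    refine analyticAt_const.mul (Finset.analyticAt_fun_sum _ fun j _ => AnalyticAt.mul ?_ analyticAt_const)
    exact aux_adj_analytic (fun x => A (x, lam x)) x (fun a b =>
      AnalyticAt.comp (g := fun p => A p a b) (hA (x, lam x) hx a b) hp) i j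
  have hY0 : Y x₀ = X₀ := by
    simp only [Y, A, hlam0]
    rw [aux_adj_eig (M x₀) lam₀ X₀ q hq heig, smul_smul, inv_mul_cancel₀ hc, one_smul]
  have hYne : ∀ᶠ x in nhds x₀, Y x ≠ 0 :=
    (hYA x₀ hx₀ hlamA).continuousAt.eventually_ne (by rw [hY0]; exact hX₀)
  have hdne : ∀ᶠ x in nhds x₀, fderiv ℝ f (x, lam x) (0, 1) ≠ 0 := by
    have h1 : ContinuousAt (fun p => fderiv ℝ f p (0, 1)) (x₀, lam x₀) := by
      rw [hlam0]
      exact (hf u hu).fderiv.continuousAt.clm_apply continuousAt_const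
    have h2 : ContinuousAt (fun x => (x, lam x)) x₀ := continuousAt_id.prodMk hlamA.continuousAt
    have h3 : ContinuousAt (fun x => fderiv ℝ f (x, lam x) (0, 1)) x₀ :=
      ContinuousAt.comp (f := fun x => (x, lam x)) (g := fun p => fderiv ℝ f p (0, 1)) h1 h2
    refine h3.eventually_ne ?_
    rw [hlam0, hder u hu]
    simpa [u] using hd0
  have hev := (hU.eventually_mem hx₀).and
    (hlamA.eventually_analyticAt.and (hlamE.and (hYne.and hdne)))
  obtain ⟨V, hV, hVo, hxV⟩ := eventually_nhds_iff.1 hev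
  refine ⟨V, hVo, hxV, fun x hx => (hV x hx).1, lam, Y, fun x hx => (hV x hx).2.1,
    fun x hx => hYA x (hV x hx).1 (hV x hx).2.1, hlam0, hY0, fun x hx => ?_⟩
  obtain ⟨hxU, -, hE, hn, hd⟩ := hV x hx
  refine ⟨hn, ?_, ?_⟩
  · have h1 : (A (x, lam x)).mulVec (Y x) = 0 := by
      simp only [Y]
      rw [Matrix.mulVec_smul, Matrix.mulVec_mulVec, Matrix.mul_adjugate]
      change _ • ((f (x, lam x)) • (1 : Matrix (Fin n) (Fin n) ℂ)).mulVec X₀ = 0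
      rw [hE]; simp
    simp only [A, Matrix.sub_mulVec] at h1
    rw [← sub_eq_zero.1 h1]
    funext i
    simp [Matrix.mulVec_diagonal]
  · have hr : (M x).charpoly.IsRoot (lam x) := by
      have := hfe (x, lam x)
      rw [hE] at this
      exact this.symm
    have h1 := (rootMultiplicity_pos (hne x)).2 hr
    have h2 : ¬ 1 < rootMultiplicity (lam x) (M x).charpoly := by
      rw [one_lt_rootMultiplicity_iff_isRoot (hne x)]
      rintro ⟨-, h⟩
      apply hd
      rw [hder (x, lam x) hxU]
      simpa using h
    omega
end
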